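/- arXiv:2408.08854 — 3 statements merged into one kernel-verified Lean document; each statement's English description precedes it below -/
import Mathlib

section
/- Let a < b be real numbers, let K ⊆ [a, b] be a compact set of Lebesgue measure zero, and let δ > 0. Then there exists a C^∞ function r : ℝ → ℝ such that: (1) r is locally constant on some open set containing K; (2) 0 ≤ r′(t) ≤ 1 for every t ∈ ℝ; (3) |r(t) − t| < δ for every t ∈ ℝ; (4) r(a) = a. -/
open MeasureTheory

/-- The integral of a function bounded by `1` in absolute value and vanishing off `U` is at most
the measure of `U`. -/
theorem abs_intervalIntegral_le_measureReal {f : ℝ → ℝ} {U : Set ℝ}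
    (hU_fin : volume U < ⊤) (hf : ∀ x, |f x| ≤ 1) (hf0 : ∀ x ∉ U, f x = 0) (s t : ℝ) :
    |∫ x in s..t, f x| ≤ volume.real U := by
  rw [intervalIntegral.abs_intervalIntegral_eq,
    setIntegral_eq_of_subset_of_forall_sdiff_eq_zero (s := Set.uIoc s t ∩ U)
      measurableSet_uIoc Set.inter_subset_left fun x hx => hf0 x fun h => hx.2 ⟨hx.1, h⟩]
  calc ‖∫ x in Set.uIoc s t ∩ U, f x‖
      ≤ 1 * volume.real (Set.uIoc s t ∩ U) :=
        norm_setIntegral_le_of_norm_le_const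
          ((measure_mono Set.inter_subset_right).trans_lt hU_fin) fun x _ => hf x
    _ ≤ volume.real U := by
        rw [one_mul]
        exact measureReal_mono Set.inter_subset_right hU_fin.ne

/-- A differentiable function on `ℝ` whose derivative vanishes on an open set is locally constant
at each of its points. -/
theorem IsOpen.eventually_eq_of_deriv_eq_zero {r : ℝ → ℝ} {U : Set ℝ} (hU : IsOpen U)
    (hr : Differentiable ℝ r) (hr0 : ∀ x ∈ U, deriv r x = 0) {x : ℝ} (hx : x ∈ U) :
    ∀ᶠ y in nhds x, r y = r x := by
  obtain ⟨ε, hε, hball⟩ := Metric.isOpen_iff.1 hU x hx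
  filter_upwards [Metric.ball_mem_nhds x hε] with y hy
  exact Metric.isOpen_ball.is_const_of_deriv_eq_zero (convex_ball x ε).isPreconnected
    hr.differentiableOn (fun z hz => hr0 z (hball hz)) hy (Metric.mem_ball_self hε)

/-- For a compact measure-zero set `K ⊆ [a,b]` and `δ > 0`, there exists a
smooth function `r : ℝ → ℝ` which is locally constant on an open set containing `K`,
has derivative in `[0,1]` everywhere, satisfies `|r(t) − t| < δ` everywhere, and
`r(a) = a`. -/
theorem exists_admissible_function
    (a b δ : ℝ) (hab : a < b) (hδ : 0 < δ)
    (K : Set ℝ) (hKcompact : IsCompact K) (hKsub : K ⊆ Set.Icc a b)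
    (hK0 : volume K = 0) :
    ∃ r : ℝ → ℝ, ContDiff ℝ (⊤ : ℕ∞) r ∧
      (∃ U : Set ℝ, IsOpen U ∧ K ⊆ U ∧ ∀ x ∈ U, ∀ᶠ y in nhds x, r y = r x) ∧
      (∀ t : ℝ, 0 ≤ deriv r t ∧ deriv r t ≤ 1) ∧
      (∀ t : ℝ, |r t - t| < δ) ∧
      r a = a := by
  obtain ⟨U, hKU, hU, hUδ⟩ := K.exists_isOpen_lt_of_lt (μ := volume) (ENNReal.ofReal δ)
    (by simpa [hK0] using hδ)
  obtain ⟨h, h_one, h_zero, h_mem⟩ := exists_contMDiffMap_one_nhds_of_subset_interior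
    (modelWithCornersSelf ℝ ℝ) (n := ⊤) hKcompact.isClosed (hU.interior_eq.symm ▸ hKU)
  have h_smooth : ContDiff ℝ (⊤ : ℕ∞) h := h.contMDiff.contDiff
  have r_deriv (t : ℝ) : HasDerivAt (fun t => t - ∫ s in a..t, h s) (1 - h t) t :=
    (hasDerivAt_id t).sub (h_smooth.continuous.integral_hasStrictDerivAt a t).hasDerivAt
  have r_diff : Differentiable ℝ fun t => t - ∫ s in a..t, h s :=
    fun t => (r_deriv t).differentiableAt
  obtain ⟨V, hV, hKV, hV_one⟩ := eventually_nhdsSet_iff_exists.1 h_one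
  refine ⟨fun t => t - ∫ s in a..t, h s, ?_, ⟨V, hV, hKV, fun x hx => ?_⟩, fun t => ?_,
    fun t => ?_, by simp⟩
  · rw [contDiff_infty_iff_deriv, funext fun t => (r_deriv t).deriv]
    exact ⟨r_diff, contDiff_const.sub h_smooth⟩
  · exact hV.eventually_eq_of_deriv_eq_zero r_diff
      (fun z hz => by rw [(r_deriv z).deriv, hV_one z hz, sub_self]) hx
  · rw [(r_deriv t).deriv]
    constructor <;> linarith [(h_mem t).1, (h_mem t).2]
  · rw [sub_sub_cancel_left, abs_neg]
    have hU_fin : volume U < ⊤ := hUδ.trans ENNReal.ofReal_lt_top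
    exact (abs_intervalIntegral_le_measureReal hU_fin
      (fun x => abs_le.2 ⟨by linarith [(h_mem x).1], (h_mem x).2⟩) h_zero a t).trans_lt
      ((ENNReal.lt_ofReal_iff_toReal_lt hU_fin.ne).1 hUδ)
end

section
/- Let q ≥ 1 be an integer and let a ≤ a_1 < b_1 ≤ a_2 < b_2 ≤ ⋯ ≤ a_q < b_q ≤ b be real numbers. Let g : ℝ → ℝ be a C^∞ function with g(a) = 0 such that g is locally constant on some open set containing [a, b] \ ⋃_{j=1}^q (a_j, b_j). Then there exist C^∞ functions f_1, …, f_q : ℝ → ℝ such that: (1) each f_j vanishes on a neighborhood of (−∞, a_j]; (2) each f_j is constant on a neighborhood of [b_j, +∞); (3) ∑_{j=1}^q f_j(t) = g(t) for every t ∈ [a, b]; (4) osc_ℝ(f_j) = osc_{[a_j, b_j]}(g) for each j, where osc_S(f) = sup_S f − inf_S f. -/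
open Filter Topology Set

/-- The variation of `g` across `[α, β]`: zero to the left of `α`, equal to `g t - g α` inside,
and constant to the right of `β`. -/
noncomputable def clampIncrement (g : ℝ → ℝ) (α β t : ℝ) : ℝ :=
  g (max α (min β t)) - g α

lemma tendsto_clamp (α β t : ℝ) :
    Tendsto (fun y : ℝ => max α (min β y)) (𝓝 t) (𝓝 (max α (min β t))) :=
  (continuous_const.max (continuous_const.min continuous_id)).tendsto t

lemma clampIncrement_eventually_zero {g : ℝ → ℝ} {α β t : ℝ}
    (hα : ∀ᶠ y in 𝓝 α, g y = g α) (ht : t ≤ α) :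
    ∀ᶠ y in 𝓝 t, clampIncrement g α β y = 0 := by
  have hc : max α (min β t) = α := max_eq_left ((min_le_right _ _).trans ht)
  have h := tendsto_clamp α β t
  rw [hc] at h
  filter_upwards [h.eventually hα] with y hy
  simp [clampIncrement, hy]

lemma clampIncrement_eventually_const {g : ℝ → ℝ} {α β t : ℝ} (hαβ : α < β)
    (hβ : ∀ᶠ y in 𝓝 β, g y = g β) (ht : β ≤ t) :
    ∀ᶠ y in 𝓝 t, clampIncrement g α β y = g β - g α := by
  have hc : max α (min β t) = β := by rw [min_eq_left ht, max_eq_right hαβ.le]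
  have h := tendsto_clamp α β t
  rw [hc] at h
  filter_upwards [h.eventually hβ] with y hy
  simp [clampIncrement, hy]

lemma clampIncrement_eventually_eq_sub {g : ℝ → ℝ} {α β t : ℝ} (ht : t ∈ Ioo α β) :
    ∀ᶠ y in 𝓝 t, clampIncrement g α β y = g y - g α := by
  filter_upwards [isOpen_Ioo.mem_nhds ht] with y hy
  rw [clampIncrement, min_eq_right hy.2.le, max_eq_right hy.1.le]

lemma contDiff_clampIncrement {g : ℝ → ℝ} {α β : ℝ} {n : WithTop ℕ∞} (hg : ContDiff ℝ n g)
    (hαβ : α < β) (hα : ∀ᶠ y in 𝓝 α, g y = g α) (hβ : ∀ᶠ y in 𝓝 β, g y = g β) :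
    ContDiff ℝ n (clampIncrement g α β) := by
  rw [contDiff_iff_contDiffAt]
  intro t
  rcases le_or_gt t α with h | h
  · exact contDiffAt_const.congr_of_eventuallyEq (clampIncrement_eventually_zero hα h)
  rcases le_or_gt β t with h' | h'
  · exact contDiffAt_const.congr_of_eventuallyEq (clampIncrement_eventually_const hαβ hβ h')
  · exact (hg.contDiffAt.sub contDiffAt_const).congr_of_eventuallyEq
      (clampIncrement_eventually_eq_sub ⟨h, h'⟩)

open Classical in
lemma hasDerivAt_clampIncrement {g : ℝ → ℝ} {α β : ℝ} (hg : Differentiable ℝ g)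
    (hαβ : α < β) (hα : ∀ᶠ y in 𝓝 α, g y = g α) (hβ : ∀ᶠ y in 𝓝 β, g y = g β) (t : ℝ) :
    HasDerivAt (clampIncrement g α β) (if t ∈ Ioo α β then deriv g t else 0) t := by
  split_ifs with ht
  · exact ((hg t).hasDerivAt.sub_const _).congr_of_eventuallyEq
      (clampIncrement_eventually_eq_sub ht)
  rcases le_or_gt t α with h | h
  · exact (hasDerivAt_const t _).congr_of_eventuallyEq (clampIncrement_eventually_zero hα h)
  · exact (hasDerivAt_const t _).congr_of_eventuallyEq
      (clampIncrement_eventually_const hαβ hβ (not_lt.mp fun h' => ht ⟨h, h'⟩))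

lemma range_clampIncrement {g : ℝ → ℝ} {α β : ℝ} (hαβ : α < β) :
    range (clampIncrement g α β) = OrderIso.subRight (g α) '' (g '' Icc α β) := by
  ext y
  constructor
  · rintro ⟨t, rfl⟩
    exact ⟨_, ⟨max α (min β t), ⟨le_max_left _ _, max_le hαβ.le (min_le_left _ _)⟩, rfl⟩, rfl⟩
  · rintro ⟨_, ⟨t, ht, rfl⟩, rfl⟩
    exact ⟨t, by simp [clampIncrement, min_eq_right ht.2, max_eq_right ht.1]⟩

lemma osc_clampIncrement {g : ℝ → ℝ} {α β : ℝ} (hg : Continuous g) (hαβ : α < β) :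
    sSup (range (clampIncrement g α β)) - sInf (range (clampIncrement g α β)) =
      sSup (g '' Icc α β) - sInf (g '' Icc α β) := by
  have hc : IsCompact (g '' Icc α β) := isCompact_Icc.image hg
  have hne : (g '' Icc α β).Nonempty := (nonempty_Icc.mpr hαβ.le).image g
  rw [range_clampIncrement hαβ, ← OrderIso.map_csSup' _ hne hc.bddAbove,
    ← OrderIso.map_csInf' _ hne hc.bddBelow]
  simp

lemma le_of_lt_of_consecutive_le {q : ℕ} {A B : Fin q → ℝ} (hAB : ∀ j, A j < B j)
    (hBA : ∀ i j : Fin q, i.val + 1 = j.val → B i ≤ A j) {i j : Fin q} (hij : i < j) :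
    B i ≤ A j := by
  have key : ∀ (d : ℕ) (k : Fin q), i.val + d + 1 = k.val → B i ≤ A k := by
    intro d
    induction d with
    | zero => exact fun k h => hBA i k h
    | succ d ih =>
      intro k h
      have hk : i.val + d + 1 < q := by omega
      exact (ih ⟨_, hk⟩ rfl).trans ((hAB _).le.trans (hBA ⟨_, hk⟩ k h))
  obtain ⟨d, hd⟩ := Nat.exists_eq_add_of_lt (Fin.lt_def.mp hij)
  exact key d j hd.symm


/-- A smooth function `g` with `g(a) = 0` that is locally constant on an
open set containing `[a,b] \ ⋃_j (a_j, b_j)` decomposes on `[a,b]` as a sum of smooth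
functions `f_j`, each vanishing near `(−∞, a_j]`, constant near `[b_j, +∞)`, and with
total oscillation equal to the oscillation of `g` on `[a_j, b_j]`. -/
theorem decomposition_into_elementary_pieces
    (q : ℕ) (hq : 0 < q) (a b : ℝ) (A B : Fin q → ℝ)
    (hAB : ∀ j : Fin q, A j < B j)
    (hBA : ∀ (j : ℕ) (h : j + 1 < q), B ⟨j, by omega⟩ ≤ A ⟨j + 1, h⟩)
    (haA : a ≤ A ⟨0, hq⟩)
    (hBb : B ⟨q - 1, by omega⟩ ≤ b)
    (g : ℝ → ℝ) (hg : ContDiff ℝ (⊤ : ℕ∞) g) (hga : g a = 0)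
    (hlc : ∃ U : Set ℝ, IsOpen U ∧
      (Set.Icc a b \ ⋃ j : Fin q, Set.Ioo (A j) (B j)) ⊆ U ∧
      ∀ x ∈ U, ∀ᶠ y in nhds x, g y = g x) :
    ∃ f : Fin q → ℝ → ℝ,
      (∀ j, ContDiff ℝ (⊤ : ℕ∞) (f j)) ∧
      (∀ j, ∃ U : Set ℝ, IsOpen U ∧ Set.Iic (A j) ⊆ U ∧ ∀ t ∈ U, f j t = 0) ∧
      (∀ j, ∃ c : ℝ, ∃ U : Set ℝ, IsOpen U ∧ Set.Ici (B j) ⊆ U ∧ ∀ t ∈ U, f j t = c) ∧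
      (∀ t ∈ Set.Icc a b, ∑ j : Fin q, f j t = g t) ∧
      (∀ j, sSup (Set.range (f j)) - sInf (Set.range (f j)) =
        sSup (g '' Set.Icc (A j) (B j)) - sInf (g '' Set.Icc (A j) (B j))) := by
  have hlt : ∀ {i j : Fin q}, i < j → B i ≤ A j := by
    refine le_of_lt_of_consecutive_le hAB ?_
    rintro i ⟨_, hj⟩ rfl
    exact hBA i hj
  have haA' : ∀ j, a ≤ A j := by
    intro j
    rcases (Fin.mk_le_of_le_val (Nat.zero_le j.val) : (⟨0, hq⟩ : Fin q) ≤ j).eq_or_lt with h | h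
    · exact h ▸ haA
    · exact haA.trans ((hAB _).le.trans (hlt h))
  have hBb' : ∀ j, B j ≤ b := by
    intro j
    have hj : j ≤ (⟨q - 1, by omega⟩ : Fin q) := Fin.le_def.mpr (Nat.le_sub_one_of_lt j.isLt)
    rcases hj.eq_or_lt with h | h
    · exact h ▸ hBb
    · exact (hlt h).trans ((hAB _).le.trans hBb)
  obtain ⟨U, -, hU, hloc⟩ := hlc
  have hconst : ∀ t ∈ Icc a b, (∀ j, t ∉ Ioo (A j) (B j)) → ∀ᶠ y in 𝓝 t, g y = g t :=
    fun t ht h => hloc t (hU ⟨ht, by simpa only [mem_iUnion, not_exists] using h⟩)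
  have hA : ∀ j, ∀ᶠ y in 𝓝 (A j), g y = g (A j) := by
    refine fun j => hconst _ ⟨haA' j, (hAB j).le.trans (hBb' j)⟩ fun i hi => ?_
    rcases lt_trichotomy i j with h | rfl | h
    · exact absurd hi.2 (hlt h).not_gt
    · exact lt_irrefl _ hi.1
    · exact absurd (hi.1.trans (hAB j)) (hlt h).not_gt
  have hB : ∀ j, ∀ᶠ y in 𝓝 (B j), g y = g (B j) := by
    refine fun j => hconst _ ⟨(haA' j).trans (hAB j).le, hBb' j⟩ fun i hi => ?_
    rcases lt_trichotomy i j with h | rfl | h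
    · exact absurd ((hAB j).trans hi.2) (hlt h).not_gt
    · exact lt_irrefl _ hi.2
    · exact absurd hi.1 (hlt h).not_gt
  have hgd : Differentiable ℝ g := hg.differentiable (by simp)
  refine ⟨fun j => clampIncrement g (A j) (B j),
    fun j => contDiff_clampIncrement hg (hAB j) (hA j) (hB j),
    fun j => ⟨_, isOpen_setOfPred_eventually_nhds,
      fun t ht => clampIncrement_eventually_zero (hA j) ht, fun t ht => ht.self_of_nhds⟩,
    fun j => ⟨g (B j) - g (A j), _, isOpen_setOfPred_eventually_nhds,
      fun t ht => clampIncrement_eventually_const (hAB j) (hB j) ht, fun t ht => ht.self_of_nhds⟩,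
    ?_, fun j => osc_clampIncrement hg.continuous (hAB j)⟩
  classical
  have hderiv : ∀ t, HasDerivAt (fun t => ∑ j, clampIncrement g (A j) (B j) t - g t)
      (∑ j, (if t ∈ Ioo (A j) (B j) then deriv g t else 0) - deriv g t) t := by
    intro t
    refine (HasDerivAt.fun_sum fun j _ => ?_).sub (hgd t).hasDerivAt
    convert hasDerivAt_clampIncrement hgd (hAB j) (hA j) (hB j) t
  have hzero : ∀ t ∈ Icc a b,
      ∑ j, (if t ∈ Ioo (A j) (B j) then deriv g t else 0) - deriv g t = 0 := by
    intro t ht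
    by_cases h : ∃ j, t ∈ Ioo (A j) (B j)
    · obtain ⟨j, hj⟩ := h
      rw [Finset.sum_eq_single j, if_pos hj, sub_self]
      · intro i _ hij
        refine if_neg fun hi => ?_
        rcases lt_or_gt_of_ne hij with h | h
        · exact absurd (hj.1.trans hi.2) (hlt h).not_gt
        · exact absurd (hi.1.trans hj.2) (hlt h).not_gt
      · simp
    · push Not at h
      have h0 : deriv g t = 0 :=
        ((hasDerivAt_const t (g t)).congr_of_eventuallyEq (hconst t ht h)).deriv
      simp [h0]
  intro t ht
  have hs := constant_of_has_deriv_right_zero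
    (fun x _ => (hderiv x).continuousAt.continuousWithinAt)
    (fun x hx => hzero x (Ico_subset_Icc_self hx) ▸ (hderiv x).hasDerivWithinAt) t ht
  have ha : ∑ j, clampIncrement g (A j) (B j) a = 0 :=
    Finset.sum_eq_zero fun j _ => (clampIncrement_eventually_zero (hA j) (haA' j)).self_of_nhds
  simp only [ha, hga, sub_zero] at hs
  exact sub_eq_zero.mp hs
end

section
/- Let T be a finite tree (a finite connected acyclic simple graph) with vertex set V and edge set E, and let μ : V → ℝ be strictly positive weights with ∑_{v∈V} μ(v) = 1. For an edge e = {v, w} ∈ E, call a function u : V → ℝ elementary with respect to e if u is constant on each of the two connected components of the graph obtained from T by deleting the edge e. Then every function h : V → ℝ with ∑_{v∈V} μ(v)·h(v) = 0 admits a unique decomposition h = ∑_{e∈E} h_e, where for each edge e the function h_e : V → ℝ is elementary with respect to e and satisfies ∑_{v∈V} μ(v)·h_e(v) = 0. -/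
namespace SimpleGraph

variable {V : Type*} {G : SimpleGraph V}

/-- A function on the vertices of a connected graph that agrees at the endpoints of every edge
and has mean zero for weights of total mass one vanishes. -/
theorem Connected.eq_zero_of_forall_adj_of_mean_eq_zero [Fintype V] (hG : G.Connected)
    {μ f : V → ℝ} (hμ : ∑ v, μ v = 1) (hadj : ∀ x y, G.Adj x y → f x = f y)
    (hmean : ∑ v, μ v * f v = 0) (v : V) : f v = 0 := by
  have hconst (x y : V) : f x = f y := by
    obtain ⟨p⟩ := hG.preconnected x y
    induction p with
    | nil => rfl
    | cons hxy _ ih => exact (hadj _ _ hxy).trans ih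
  simpa [hconst _ v, ← Finset.sum_mul, hμ] using hmean

/-- In a sum of functions that are elementary with respect to the edges of a graph, only the
summand belonging to the edge `s(v, w)` contributes to the jump from `w` to `v`. -/
theorem sum_sub_sum_eq_of_adj [Fintype G.edgeSet] {H : G.edgeSet → V → ℝ}
    (hH : ∀ (e : G.edgeSet) (x y : V),
      (G.deleteEdges {(e : Sym2 V)}).Reachable x y → H e x = H e y)
    {v w : V} (hvw : G.Adj v w) :
    ∑ e, H e v - ∑ e, H e w = H ⟨s(v, w), hvw⟩ v - H ⟨s(v, w), hvw⟩ w := by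
  rw [← Finset.sum_sub_distrib]
  refine Finset.sum_eq_single_of_mem _ (Finset.mem_univ _) fun e _ he ↦ ?_
  refine sub_eq_zero.2 (hH e v w (Adj.reachable ?_))
  rw [deleteEdges_adj]
  exact ⟨hvw, fun h ↦ he (Subtype.ext h.symm)⟩

/-- For every bridge there is a mean-zero elementary function with the same jump across the bridge
as a given function. -/
theorem IsBridge.exists_elementary [Fintype V] {e : Sym2 V} (he : G.IsBridge e)
    {μ : V → ℝ} (hμ : ∑ v, μ v = 1) (h : V → ℝ) :
    ∃ u : V → ℝ, (∀ x y, (G.deleteEdges {e}).Reachable x y → u x = u y) ∧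
      ∑ v, μ v * u v = 0 ∧ ∀ x y, s(x, y) = e → u x - u y = h x - h y := by
  classical
  induction e with | h v w
  rw [isBridge_iff] at he
  let u (x : V) : ℝ := if (G.deleteEdges {s(v, w)}).Reachable v x then h v - h w else 0
  refine ⟨fun x ↦ u x - ∑ z, μ z * u z, fun x y hxy ↦ ?_, ?_, fun x y hxy ↦ ?_⟩
  · have hiff : (G.deleteEdges {s(v, w)}).Reachable v x ↔
        (G.deleteEdges {s(v, w)}).Reachable v y :=
      ⟨fun hx ↦ hx.trans hxy, fun hy ↦ hy.trans hxy.symm⟩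
    simp only [u, hiff]
  · simp only [mul_sub, Finset.sum_sub_distrib, ← Finset.sum_mul, hμ, one_mul, sub_self]
  · have hv : u v = h v - h w := if_pos (Reachable.refl v)
    have hw : u w = 0 := if_neg he
    rcases Sym2.eq_iff.1 hxy with ⟨rfl, rfl⟩ | ⟨rfl, rfl⟩ <;> linarith

end SimpleGraph

/-- On a finite tree with strictly positive vertex weights summing to 1,
every mean-zero function `h` on the vertices decomposes uniquely as a sum over the
edges of mean-zero functions, each of which is elementary with respect to its edge
(i.e. constant on each connected component of the graph with that edge deleted). -/
theorem tree_elementary_decomposition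
    {V : Type*} [Fintype V] [DecidableEq V]
    (T : SimpleGraph V) [DecidableRel T.Adj] (hT : T.IsTree)
    (μ : V → ℝ) (hμpos : ∀ v, 0 < μ v) (hμsum : ∑ v, μ v = 1)
    (h : V → ℝ) (hmean : ∑ v, μ v * h v = 0) :
    ∃! H : T.edgeSet → (V → ℝ),
      (∀ v, ∑ e : T.edgeSet, H e v = h v) ∧
      (∀ e : T.edgeSet,
        (∀ x y : V, (T.deleteEdges {(e : Sym2 V)}).Reachable x y → H e x = H e y) ∧
        ∑ v, μ v * H e v = 0) := by
  have hjump (e : T.edgeSet) := (SimpleGraph.isAcyclic_iff_forall_isBridge.1 hT.isAcyclic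
    e.2).exists_elementary hμsum h
  choose H hconst hzero hH using hjump
  refine ⟨H, ⟨fun v ↦ ?_, fun e ↦ ⟨hconst e, hzero e⟩⟩, fun K ⟨hKsum, hK⟩ ↦ ?_⟩
  · refine sub_eq_zero.1 (hT.connected.eq_zero_of_forall_adj_of_mean_eq_zero
      (f := fun v ↦ ∑ e, H e v - h v) hμsum (fun x y hxy ↦ ?_) ?_ v)
    · linarith [SimpleGraph.sum_sub_sum_eq_of_adj hconst hxy, hH ⟨s(x, y), hxy⟩ x y rfl]
    · simp only [mul_sub, Finset.sum_sub_distrib, hmean, sub_zero, Finset.mul_sum]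
      rw [Finset.sum_comm]
      exact Finset.sum_eq_zero fun e _ ↦ hzero e
  · funext e v
    refine sub_eq_zero.1 (hT.connected.eq_zero_of_forall_adj_of_mean_eq_zero
      (f := fun v ↦ K e v - H e v) hμsum (fun x y hxy ↦ ?_) ?_ v)
    · by_cases he : s(x, y) = (e : Sym2 V)
      · have hjump := SimpleGraph.sum_sub_sum_eq_of_adj (fun e ↦ (hK e).1) hxy
        rw [hKsum, hKsum, show (⟨s(x, y), hxy⟩ : T.edgeSet) = e from Subtype.ext he] at hjump
        linarith [hH e x y he]
      · have hreach : (T.deleteEdges {(e : Sym2 V)}).Reachable x y :=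
          SimpleGraph.Adj.reachable (SimpleGraph.deleteEdges_adj.2 ⟨hxy, he⟩)
        rw [(hK e).1 x y hreach, hconst e x y hreach]
    · simp only [mul_sub, Finset.sum_sub_distrib, (hK e).2, hzero e, sub_zero]
end
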